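/- arXiv:2112.10016 — 5 statements merged into one kernel-verified Lean document; each statement's English description precedes it below -/
import Mathlib

section
/- Let R be a prime ring (the zero two-sided ideal is prime: for all a, b ∈ R, if aRb = 0 then a = 0 or b = 0) which is a Zorn ring, i.e., every nonzero right ideal of R contains a nonzero idempotent. Suppose the intersection I of all the nonzero prime two-sided ideals of R is nonzero. Then there exists a nonzero idempotent u ∈ I such that u belongs to every nonzero two-sided ideal of R; in particular, the zero ideal of R is completely irreducible. -/
/-- A two-sided ideal `P` of a ring `R` is prime if `P ≠ R` and for all `a b ∈ R`,
`aRb ⊆ P` implies `a ∈ P` or `b ∈ P`. -/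
def TwoSidedIdeal.IsPrimeIdeal {R : Type*} [Ring R] (P : TwoSidedIdeal R) : Prop :=
  P ≠ ⊤ ∧ ∀ a b : R, (∀ r : R, a * r * b ∈ P) → a ∈ P ∨ b ∈ P

namespace TwoSidedIdeal

/-- A two-sided ideal that is maximal among those not containing a fixed idempotent is prime. -/
theorem isPrimeIdeal_of_maximal_notMem {R : Type*} [Ring R] {u : R} (hu : u * u = u)
    {P : TwoSidedIdeal R} (hP : Maximal (fun K : TwoSidedIdeal R => u ∉ K) P) :
    P.IsPrimeIdeal := by
  have mem_of_le_of_notMem : ∀ K : TwoSidedIdeal R, P ≤ K → ∀ x ∈ K, x ∉ P → u ∈ K := by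
    intro K hPK x hxK hxP
    by_contra huK
    exact hxP (hP.2 huK hPK hxK)
  refine ⟨fun h => hP.1 (h ▸ trivial), fun a b hab => ?_⟩
  by_contra! h
  let A : TwoSidedIdeal R := .mk' {x | ∀ r, x * r * b ∈ P}
    (fun r => by simp [P.zero_mem])
    (fun hx hy r => by simpa only [add_mul] using P.add_mem (hx r) (hy r))
    (fun hx r => by simpa only [neg_mul] using P.neg_mem (hx r))
    (fun {x y} hy r => by simpa only [mul_assoc] using P.mul_mem_left x _ (hy r))
    (fun {x y} hx r => by simpa only [mul_assoc] using hx (y * r))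
  have mem_A : ∀ x, x ∈ A ↔ ∀ r, x * r * b ∈ P := fun x => mem_mk' ..
  have huA := (mem_A u).1 <| mem_of_le_of_notMem A
    (fun x hx => (mem_A x).2 fun r => P.mul_mem_right _ _ (P.mul_mem_right _ _ hx))
    a ((mem_A a).2 hab) h.1
  let B : TwoSidedIdeal R := .mk' {y | ∀ r, u * r * y ∈ P}
    (fun r => by simp [P.zero_mem])
    (fun hx hy r => by simpa only [mul_add] using P.add_mem (hx r) (hy r))
    (fun hx r => by simpa only [mul_neg] using P.neg_mem (hx r))
    (fun {x y} hy r => by simpa only [mul_assoc] using hy (r * x))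
    (fun {x y} hx r => by simpa only [mul_assoc] using P.mul_mem_right _ y (hx r))
  have mem_B : ∀ y, y ∈ B ↔ ∀ r, u * r * y ∈ P := fun y => mem_mk' ..
  have huB := (mem_B u).1 <| mem_of_le_of_notMem B
    (fun x hx => (mem_B x).2 fun r => P.mul_mem_left _ _ hx) b ((mem_B b).2 huA) h.2
  exact hP.1 (by simpa [hu] using huB 1)

/-- A two-sided ideal not containing `u` is contained in one maximal with this property. -/
theorem exists_le_maximal_notMem {R : Type*} [Ring R] {u : R} {J : TwoSidedIdeal R}
    (hJ : u ∉ J) : ∃ P, J ≤ P ∧ Maximal (fun K : TwoSidedIdeal R => u ∉ K) P := by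
  refine zorn_le_nonempty₀ {K : TwoSidedIdeal R | u ∉ K} (fun c hc hchain K₀ hK₀ => ?_) J hJ
  let S : TwoSidedIdeal R := .mk' {x | ∃ K ∈ c, x ∈ K}
    ⟨K₀, hK₀, K₀.zero_mem⟩
    (by
      rintro x y ⟨K, hK, hx⟩ ⟨L, hL, hy⟩
      rcases hchain.total hK hL with h | h
      · exact ⟨L, hL, L.add_mem (h hx) hy⟩
      · exact ⟨K, hK, K.add_mem hx (h hy)⟩)
    (fun ⟨K, hK, hx⟩ => ⟨K, hK, K.neg_mem hx⟩)
    (fun ⟨K, hK, hx⟩ => ⟨K, hK, K.mul_mem_left _ _ hx⟩)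
    (fun ⟨K, hK, hx⟩ => ⟨K, hK, K.mul_mem_right _ _ hx⟩)
  have mem_S : ∀ x, x ∈ S ↔ ∃ K ∈ c, x ∈ K := fun x => mem_mk' ..
  refine ⟨S, fun h => ?_, fun K hK x hx => (mem_S x).2 ⟨K, hK, hx⟩⟩
  obtain ⟨K, hK, hu⟩ := (mem_S u).1 h
  exact hc hK hu

/-- An idempotent lying in every nonzero prime ideal lies in every nonzero ideal. -/
theorem mem_of_mem_sInf_isPrimeIdeal {R : Type*} [Ring R] {u : R} (hu : u * u = u)
    (huI : u ∈ sInf {P : TwoSidedIdeal R | P ≠ ⊥ ∧ P.IsPrimeIdeal})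
    {J : TwoSidedIdeal R} (hJ : J ≠ ⊥) : u ∈ J := by
  by_contra h
  obtain ⟨P, hJP, hP⟩ := exists_le_maximal_notMem h
  exact hP.1 ((mem_sInf R).1 huI P
    ⟨fun h => hJ (le_bot_iff.1 (h ▸ hJP)), isPrimeIdeal_of_maximal_notMem hu hP⟩)

end TwoSidedIdeal

/-- Let `R` be a prime ring (for all `a b`, `aRb = 0` implies `a = 0` or `b = 0`) which is a
Zorn ring: every nonzero right ideal of `R` (i.e. nonzero `Rᵐᵒᵖ`-submodule of `R`) contains a
nonzero idempotent.  If the intersection `I` of all the nonzero prime two-sided ideals of `R`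
is nonzero, then there is a nonzero idempotent `u ∈ I` belonging to every nonzero two-sided
ideal of `R`; in particular the zero two-sided ideal of `R` is completely irreducible, i.e.
it is not the intersection of all the two-sided ideals properly containing it. -/
theorem zero_completelyIrreducible_of_zornRing
    {R : Type*} [Ring R] [Nontrivial R]
    (hprime : ∀ a b : R, (∀ r : R, a * r * b = 0) → a = 0 ∨ b = 0)
    (hzorn : ∀ J : Submodule Rᵐᵒᵖ R, J ≠ ⊥ → ∃ u ∈ J, u ≠ 0 ∧ u * u = u)
    (hI : sInf {P : TwoSidedIdeal R | P ≠ ⊥ ∧ P.IsPrimeIdeal} ≠ ⊥) :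
    (∃ u : R, u ≠ 0 ∧ u * u = u ∧
        u ∈ sInf {P : TwoSidedIdeal R | P ≠ ⊥ ∧ P.IsPrimeIdeal} ∧
        ∀ J : TwoSidedIdeal R, J ≠ ⊥ → u ∈ J) ∧
      (⊥ : TwoSidedIdeal R) ≠ sInf {J : TwoSidedIdeal R | ⊥ < J} := by
  set I := sInf {P : TwoSidedIdeal R | P ≠ ⊥ ∧ P.IsPrimeIdeal}
  let J : Submodule Rᵐᵒᵖ R :=
    { carrier := {x | x ∈ I}
      add_mem' := fun hx hy => I.add_mem hx hy
      zero_mem' := I.zero_mem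
      smul_mem' := fun r x hx => I.mul_mem_right x r.unop hx }
  have hJ : J ≠ ⊥ := by
    intro h
    refine hI (le_bot_iff.1 fun x hx => ?_)
    have hx' : x ∈ J := hx
    rw [h, Submodule.mem_bot] at hx'
    exact (TwoSidedIdeal.mem_bot R).2 hx'
  obtain ⟨u, huI, hu0, hu⟩ := hzorn J hJ
  have hmem : ∀ K : TwoSidedIdeal R, K ≠ ⊥ → u ∈ K :=
    fun K hK => TwoSidedIdeal.mem_of_mem_sInf_isPrimeIdeal hu huI hK
  refine ⟨⟨u, hu0, hu, huI, hmem⟩, fun h => hu0 ?_⟩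
  rw [← TwoSidedIdeal.mem_bot R, h]
  exact (TwoSidedIdeal.mem_sInf R).2 fun K hK => hmem K hK.ne'
end

section
/- Let R be a ring that is semiprimitive in the sense that for every nonzero x ∈ R there exists a simple left R-module M with x ∉ Ann(M) (equivalently, the intersection of the annihilators of all simple left R-modules is zero). Suppose the zero two-sided ideal of R is prime and is locally closed, i.e., there exists a nonzero element a ∈ R belonging to every nonzero prime two-sided ideal of R. Then R is left primitive: there exists a simple left R-module M that is faithful (Ann(M) = 0). -/
universe u

/-- The annihilator of a simple module is a prime ideal in the elementwise sense. -/
theorem IsSimpleModule.mem_annihilator_or_mem_annihilator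
    {R M : Type*} [Ring R] [AddCommGroup M] [Module R M] [IsSimpleModule R M] {x y : R}
    (h : ∀ r : R, x * r * y ∈ Module.annihilator R M) :
    x ∈ Module.annihilator R M ∨ y ∈ Module.annihilator R M := by
  refine or_iff_not_imp_right.2 fun hy => ?_
  simp only [Module.mem_annihilator, not_forall] at hy
  obtain ⟨m, hm⟩ := hy
  refine Module.mem_annihilator.2 fun n => ?_
  obtain ⟨r, rfl⟩ := IsSimpleModule.toSpanSingleton_surjective R hm n
  simpa [mul_smul] using Module.mem_annihilator.1 (h r) m

/-- Let `R` be a semiprimitive ring: for every nonzero `x ∈ R` there is a simple left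
`R`-module `M` with `x ∉ Ann(M)` (the intersection of the annihilators of all simple left
`R`-modules is zero).  If the zero two-sided ideal of `R` is prime and locally closed
(there exists a nonzero `a ∈ R` belonging to every nonzero prime two-sided ideal of `R`),
then `R` is left primitive: there is a simple faithful left `R`-module. -/
theorem primitive_of_semiprimitive_locallyClosed
    {R : Type u} [Ring R] [Nontrivial R]
    (hsemiprim : ∀ x : R, x ≠ 0 →
      ∃ (M : Type u) (_ : AddCommGroup M) (_ : Module R M),
        IsSimpleModule R M ∧ x ∉ Module.annihilator R M)
    (hprime : ∀ a b : R, (∀ r : R, a * r * b = 0) → a = 0 ∨ b = 0)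
    (hlc : ∃ a : R, a ≠ 0 ∧ ∀ P : TwoSidedIdeal R,
        (P ≠ ⊤ ∧ ∀ x y : R, (∀ r : R, x * r * y ∈ P) → x ∈ P ∨ y ∈ P) →
          P ≠ ⊥ → a ∈ P) :
    ∃ (M : Type u) (_ : AddCommGroup M) (_ : Module R M),
      IsSimpleModule R M ∧ Module.annihilator R M = ⊥ := by
  obtain ⟨a, ha, hlc⟩ := hlc
  obtain ⟨M, _, _, _, haM⟩ := hsemiprim a ha
  refine ⟨M, _, _, ‹_›, ?_⟩
  by_contra hne
  refine haM (Ideal.mem_toTwoSided.1 (hlc (Module.annihilator R M).toTwoSided ⟨?_, ?_⟩ ?_))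
  · intro htop
    exact haM (Ideal.mem_toTwoSided.1 (htop ▸ trivial))
  · simpa only [Ideal.mem_toTwoSided] using
      fun x y => IsSimpleModule.mem_annihilator_or_mem_annihilator
  · intro hbot
    refine hne ((Submodule.eq_bot_iff _).2 fun x hx => ?_)
    exact (TwoSidedIdeal.mem_bot R).1 (hbot ▸ Ideal.mem_toTwoSided.2 hx)
end

section
/- Let E be a finite directed graph (finitely many vertices and finitely many edges). Then every vertex of E connects to a sink, or to a cycle without exits, or to an extreme cycle; that is, for every vertex u there is a path from u to a sink, or a path from u to a vertex lying on a cycle without exits, or a path from u to a vertex lying on an extreme cycle. -/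
/-- A directed graph: a set of vertices, a set of edges, and source and range maps. -/
structure DGraph where
  V : Type
  E : Type
  s : E → V
  r : E → V

namespace DGraph

variable (G : DGraph)

/-- `G.Connects u v` (written `u ≥ v` in the literature) means there is a (possibly trivial)
path from `u` to `v`. -/
def Connects (u v : G.V) : Prop :=
  Relation.ReflTransGen (fun a b => ∃ e : G.E, G.s e = a ∧ G.r e = b) u v

/-- A sink is a vertex emitting no edges. -/
def IsSink (v : G.V) : Prop := ∀ e : G.E, G.s e ≠ v

/-- A cycle of length `n + 1`, presented as edges `e 0, …, e n` with
`r (e i) = s (e (i+1))` cyclically (so in particular `r (e n) = s (e 0)`) and with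
pairwise distinct sources. -/
def IsCycle {n : ℕ} (e : Fin (n + 1) → G.E) : Prop :=
  (∀ i : Fin (n + 1), G.r (e i) = G.s (e (i + 1))) ∧
    Function.Injective fun i : Fin (n + 1) => G.s (e i)

/-- An exit for the cycle `e` is an edge `f` with `s f = s (e i)` for some `i` but
`f ≠ e i`. -/
def HasExit {n : ℕ} (e : Fin (n + 1) → G.E) : Prop :=
  ∃ (i : Fin (n + 1)) (f : G.E), G.s f = G.s (e i) ∧ f ≠ e i

/-- A cycle `e` is an extreme cycle if it has an exit and every path starting at a vertex of
the cycle can be extended to a path returning to the cycle: for every vertex `v` reachable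
from the cycle, the cycle is reachable from `v`. -/
def IsExtremeCycle {n : ℕ} (e : Fin (n + 1) → G.E) : Prop :=
  G.IsCycle e ∧ G.HasExit e ∧
    ∀ v : G.V, (∃ i : Fin (n + 1), G.Connects (G.s (e i)) v) →
      ∃ i : Fin (n + 1), G.Connects v (G.s (e i))

end DGraph

theorem Function.exists_mem_periodicPts {α : Type*} [Finite α] (f : α → α) (x : α) :
    ∃ p, p ∈ Function.periodicPts f := by
  obtain ⟨m, n, hmn, h⟩ := Finite.exists_ne_map_eq_of_infinite fun n : ℕ => f^[n] x
  wlog hlt : m < n generalizing m n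
  · exact this n m hmn.symm h.symm (by omega)
  refine ⟨f^[m] x, n - m, by omega, ?_⟩
  change f^[n - m] (f^[m] x) = f^[m] x
  rw [← Function.iterate_add_apply, Nat.sub_add_cancel hlt.le]
  exact h.symm

namespace DGraph

variable (G : DGraph)

/-- In a graph with finitely many vertices, every vertex connects to a vertex `v` that is
reachable from everything `v` connects to. -/
theorem exists_connects_terminal [Finite G.V] (u : G.V) :
    ∃ v, G.Connects u v ∧ ∀ w, G.Connects v w → G.Connects w v := by
  obtain ⟨v, huv, hmin⟩ := exists_minimalFor_of_wellFoundedLT (fun v => G.Connects u v)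
    (fun v => {w | G.Connects v w}) ⟨u, Relation.ReflTransGen.refl⟩
  refine ⟨v, huv, fun w hvw => ?_⟩
  exact hmin (huv.trans hvw) (fun x hwx => hvw.trans hwx) Relation.ReflTransGen.refl

/-- In a graph with finitely many vertices, a vertex that connects to no sink connects to every
vertex of some cycle. -/
theorem exists_isCycle_of_not_isSink [Finite G.V] (v : G.V)
    (hv : ∀ w, G.Connects v w → ¬ G.IsSink w) :
    ∃ (n : ℕ) (e : Fin (n + 1) → G.E), G.IsCycle e ∧ ∀ i, G.Connects v (G.s (e i)) := by
  have hex : ∀ w : {w // G.Connects v w}, ∃ e, G.s e = w := fun w => by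
    simpa [IsSink] using hv w w.2
  choose c hc using hex
  let next : {w // G.Connects v w} → {w // G.Connects v w} :=
    fun w => ⟨G.r (c w), w.2.tail ⟨c w, hc w, rfl⟩⟩
  obtain ⟨p, hp⟩ := Function.exists_mem_periodicPts next ⟨v, Relation.ReflTransGen.refl⟩
  obtain ⟨n, hn⟩ := Nat.exists_eq_succ_of_ne_zero
    (Function.minimalPeriod_pos_of_mem_periodicPts hp).ne'
  refine ⟨n, fun i => c (next^[i] p), ⟨fun i => ?_, fun i j hij => ?_⟩, fun i => ?_⟩
  · have hstep : next^[(i + 1 : Fin (n + 1))] p = next (next^[i] p) := by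
      rw [← Function.iterate_succ_apply' next, Fin.val_add, Fin.val_one', Nat.add_mod_mod]
      have hmod := Function.iterate_mod_minimalPeriod_eq (f := next) (x := p) (n := i + 1)
      rwa [hn] at hmod
    rw [hc, hstep]
  · simp only [hc] at hij
    refine Fin.ext (Function.iterate_injOn_Iio_minimalPeriod (f := next) (x := p) ?_ ?_
      (Subtype.ext hij)) <;> simp [hn, Fin.is_le]
  · rw [hc]
    exact (next^[i] p).2

end DGraph

/-- In a finite directed graph, every vertex connects to a sink, or to a cycle without
exits, or to an extreme cycle. -/
theorem finite_graph_connects_sink_or_noExitCycle_or_extremeCycle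
    (G : DGraph) [Finite G.V] [Finite G.E] (u : G.V) :
    (∃ v : G.V, G.IsSink v ∧ G.Connects u v) ∨
    (∃ (n : ℕ) (e : Fin (n + 1) → G.E), G.IsCycle e ∧ ¬ G.HasExit e ∧
        ∃ i : Fin (n + 1), G.Connects u (G.s (e i))) ∨
    (∃ (n : ℕ) (e : Fin (n + 1) → G.E), G.IsExtremeCycle e ∧
        ∃ i : Fin (n + 1), G.Connects u (G.s (e i))) := by
  obtain ⟨v, huv, hv⟩ := G.exists_connects_terminal u
  by_cases hsink : ∃ w, G.IsSink w ∧ G.Connects v w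
  · obtain ⟨w, hw, hvw⟩ := hsink
    exact .inl ⟨w, hw, huv.trans hvw⟩
  obtain ⟨n, e, he, hve⟩ := G.exists_isCycle_of_not_isSink v
    fun w hvw hw => hsink ⟨w, hw, hvw⟩
  have hue : G.Connects u (G.s (e 0)) := huv.trans (hve 0)
  by_cases hexit : G.HasExit e
  · refine .inr (.inr ⟨n, e, ⟨he, hexit, ?_⟩, 0, hue⟩)
    rintro w ⟨i, hiw⟩
    exact ⟨0, (hv w ((hve i).trans hiw)).trans (hve 0)⟩
  · exact .inr (.inl ⟨n, e, he, hexit, 0, hue⟩)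
end

section
/- Let E be a finite directed graph with no sinks in which every cycle has an exit (Condition (L)). Then every vertex of E connects to an extreme cycle: for every vertex u there is a path from u to a vertex lying on an extreme cycle. -/
namespace DGraph

variable (G : DGraph)

/-- In a finite graph every vertex connects to a vertex `w` such that every vertex reachable
from `w` connects back to `w`. -/
theorem exists_connects_forall_connects_back [Finite G.V] (u : G.V) :
    ∃ w, G.Connects u w ∧ ∀ v, G.Connects w v → G.Connects v w := by
  obtain ⟨w, hw, hmin⟩ := Set.exists_min_image {w | G.Connects u w}
    (fun w => {v | G.Connects w v}.ncard) (Set.toFinite _) ⟨u, Relation.ReflTransGen.refl⟩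
  refine ⟨w, hw, fun v hv => ?_⟩
  have hsub : {x | G.Connects v x} ⊆ {x | G.Connects w x} :=
    fun x hx => Relation.ReflTransGen.trans hv hx
  have heq := Set.eq_of_subset_of_ncard_le hsub
    (hmin v (Relation.ReflTransGen.trans hw hv)) (Set.toFinite _)
  have hmem : w ∈ {x | G.Connects w x} := Relation.ReflTransGen.refl
  rwa [← heq] at hmem

/-- In a graph without sinks and with finitely many vertices, every vertex connects to a
cycle. -/
theorem exists_isCycle_connects [Finite G.V] (hnosink : ∀ v : G.V, ¬ G.IsSink v) (w : G.V) :
    ∃ (n : ℕ) (e : Fin (n + 1) → G.E), G.IsCycle e ∧ G.Connects w (G.s (e 0)) := by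
  have hout : ∀ v : G.V, ∃ e : G.E, G.s e = v := by
    simpa [IsSink] using hnosink
  choose f hf using hout
  let g : G.V → G.V := fun v => G.r (f v)
  have hreach : ∀ k, G.Connects w (g^[k] w) := by
    intro k
    induction k with
    | zero => exact Relation.ReflTransGen.refl
    | succ k ih =>
      rw [Function.iterate_succ_apply']
      exact Relation.ReflTransGen.tail ih ⟨f _, hf _, rfl⟩
  obtain ⟨a, b, hab, h⟩ : ∃ a b : ℕ, a < b ∧ g^[a] w = g^[b] w := by
    obtain ⟨a, b, hne, h⟩ := Finite.exists_ne_map_eq_of_infinite fun k : ℕ => g^[k] w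
    rcases hne.lt_or_gt with hlt | hlt
    exacts [⟨a, b, hlt, h⟩, ⟨b, a, hlt, h.symm⟩]
  set p := g^[a] w with hp
  have hper : p ∈ Function.periodicPts g := by
    refine ⟨b - a, by lia, ?_⟩
    rw [Function.IsPeriodicPt, Function.IsFixedPt, hp, ← Function.iterate_add_apply,
      Nat.sub_add_cancel hab.le, ← h]
  obtain ⟨n, hn⟩ := Nat.exists_eq_succ_of_ne_zero
    (Function.minimalPeriod_pos_of_mem_periodicPts hper).ne'
  refine ⟨n, fun i => f (g^[i] p), ⟨fun i => ?_, fun i j hij => ?_⟩, ?_⟩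
  · have hmod : (↑(i + 1) : ℕ) = (i + 1) % Function.minimalPeriod g p := by
      rw [hn, Fin.val_add, Fin.val_one', Nat.add_mod_mod]
    rw [hf, hmod, Function.iterate_mod_minimalPeriod_eq, Function.iterate_succ_apply']
  · simp only [hf] at hij
    exact Fin.ext (Function.iterate_injOn_Iio_minimalPeriod
      (Set.mem_Iio.2 (hn ▸ i.2)) (Set.mem_Iio.2 (hn ▸ j.2)) hij)
  · rw [hf]
    exact hreach a

/-- The vertices of a cycle are reachable from its base vertex. -/
theorem IsCycle.connects {G : DGraph} {n : ℕ} {e : Fin (n + 1) → G.E} (h : G.IsCycle e)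
    (i : Fin (n + 1)) : G.Connects (G.s (e 0)) (G.s (e i)) := by
  induction i using Fin.induction with
  | zero => exact Relation.ReflTransGen.refl
  | succ i ih =>
    refine Relation.ReflTransGen.tail ih ⟨e i.castSucc, rfl, ?_⟩
    rw [h.1, Fin.coeSucc_eq_succ]

end DGraph

/-- In a finite directed graph with no sinks in which every cycle has an exit (Condition
(L)), every vertex connects to an extreme cycle. -/
theorem connects_to_extremeCycle_of_no_sinks_condL
    (G : DGraph) [Finite G.V] [Finite G.E]
    (hnosink : ∀ v : G.V, ¬ G.IsSink v)
    (hL : ∀ (n : ℕ) (e : Fin (n + 1) → G.E), G.IsCycle e → G.HasExit e)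
    (u : G.V) :
    ∃ (n : ℕ) (e : Fin (n + 1) → G.E), G.IsExtremeCycle e ∧
      ∃ i : Fin (n + 1), G.Connects u (G.s (e i)) := by
  obtain ⟨w, huw, hback⟩ := G.exists_connects_forall_connects_back u
  obtain ⟨n, e, he, hwe⟩ := G.exists_isCycle_connects hnosink w
  refine ⟨n, e, ⟨he, hL n e he, ?_⟩, 0, Relation.ReflTransGen.trans huw hwe⟩
  rintro v ⟨i, hi⟩
  have hwv : G.Connects w v :=
    Relation.ReflTransGen.trans hwe (Relation.ReflTransGen.trans (he.connects i) hi)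
  exact ⟨0, Relation.ReflTransGen.trans (hback v hwv) hwe⟩
end

section
/- Let E be a directed graph whose vertex set E⁰ is downward directed, and let c be an extreme cycle in E. Then every vertex of E connects to c: for every vertex u ∈ E⁰ there exists a vertex v ∈ c⁰ with u ≥ v. In particular, any two extreme cycles in a downward directed graph are connected to each other. -/
/-- In a downward directed graph, every vertex connects to any given extreme cycle. -/
theorem DGraph.IsExtremeCycle.exists_connects {G : DGraph}
    (hdd : ∀ u v : G.V, ∃ w : G.V, G.Connects u w ∧ G.Connects v w)
    {n : ℕ} {e : Fin (n + 1) → G.E} (he : G.IsExtremeCycle e) (u : G.V) :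
    ∃ i : Fin (n + 1), G.Connects u (G.s (e i)) := by
  obtain ⟨w, huw, hew⟩ := hdd u (G.s (e 0))
  obtain ⟨i, hwi⟩ := he.2.2 w ⟨0, hew⟩
  exact ⟨i, Relation.ReflTransGen.trans huw hwi⟩

/-- In a directed graph with downward directed vertex set, every vertex connects to any
given extreme cycle; in particular, any two extreme cycles are connected to each other. -/
theorem connects_to_extremeCycle_of_downward_directed
    (G : DGraph)
    (hdd : ∀ u v : G.V, ∃ w : G.V, G.Connects u w ∧ G.Connects v w)
    {n : ℕ} (e : Fin (n + 1) → G.E) (he : G.IsExtremeCycle e) :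
    (∀ u : G.V, ∃ i : Fin (n + 1), G.Connects u (G.s (e i))) ∧
      ∀ {m : ℕ} (f : Fin (m + 1) → G.E), G.IsExtremeCycle f →
        (∀ j : Fin (m + 1), ∃ i : Fin (n + 1), G.Connects (G.s (f j)) (G.s (e i))) ∧
        (∀ i : Fin (n + 1), ∃ j : Fin (m + 1), G.Connects (G.s (e i)) (G.s (f j))) := by
  exact ⟨he.exists_connects hdd, fun _ hf =>
    ⟨fun _ => he.exists_connects hdd _, fun _ => hf.exists_connects hdd _⟩⟩
end
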